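/- Let n ≥ 1 and C₀ > 0. Let ω : [0,∞) → [0,∞) be nondecreasing and subadditive (ω(s+t) ≤ ω(s) + ω(t)). Let F₁, F₂, F₃ : [0,∞) → [0,∞) with F₁ nondecreasing and F₂, F₃ nonincreasing. Let K : ℝⁿ × ℝⁿ × ℝⁿ → ℂ be measurable and satisfy the smoothness condition: whenever |x − x'| ≤ max(|x−y|, |x−z|)/2 and s := |x−y| + |x−z| > 0, one has |K(x,y,z) − K(x',y,z)| ≤ C₀ · ω(|x−x'|/s) · F₁(s) F₂(s) F₃(1 + (|x+y| + |x+z|)/(1+s)) / s^{2n}. Let ℓ > 0, let k ≥ 3 be an integer, and let n₁, n₂ ∈ ℤⁿ with m := max(|n₁|, |n₂|) satisfying 2^{k−3} < m ≤ 2^{k−2}. Set I := Q(c, ℓ), I₁ := I + ℓ n₁, I₂ := I + ℓ n₂, and let K₀ be any cube containing I ∪ I₁ ∪ I₂. Then: (a) for all x ∈ I, y ∈ I₁, z ∈ I₂ one has 2^{k−3} ℓ ≤ |x−y| + |x−z| ≤ 2^k ℓ; and (b) ∫_{I₁} ∫_{I₂} ∫_{I} |K(x,y,z) − K(c,y,z)|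 dx dz dy ≤ 2^{6n+2} C₀ · ω(2^{−k}) · F₁(2^k ℓ) · F₂(2^{k−3} ℓ) · F₃(M(K₀)) · ℓ^{3n} / (2^k ℓ)^{2n}, where M(K₀) := inf_{x,y,z ∈ K₀} (1 + |x−y| + |x−z| + |x+y| + |x+z|)/(1 + |x−y| + |x−z|). -/

import Mathlib

open MeasureTheory

/-- The closed cube in `ℝⁿ` with center `c` and sidelength `ℓ`, for the sup norm
`‖x‖ = max_i |x_i|`. -/
def cube (n : ℕ) (c : Fin n → ℝ) (ℓ : ℝ) : Set (Fin n → ℝ) :=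
  {x | ‖x - c‖ ≤ ℓ / 2}

/-- `M(Q) = inf_{x,y,z ∈ Q} (1+|x−y|+|x−z|+|x+y|+|x+z|)/(1+|x−y|+|x−z|)` for the cube
`Q = Q(c,ℓ)`. -/
noncomputable def Mfun (n : ℕ) (c : Fin n → ℝ) (ℓ : ℝ) : ℝ :=
  sInf {r : ℝ | ∃ x ∈ cube n c ℓ, ∃ y ∈ cube n c ℓ, ∃ z ∈ cube n c ℓ,
    r = (1 + ‖x - y‖ + ‖x - z‖ + ‖x + y‖ + ‖x + z‖) / (1 + ‖x - y‖ + ‖x - z‖)}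

theorem cube_eq_closedBall (n : ℕ) (c : Fin n → ℝ) (ℓ : ℝ) :
    cube n c ℓ = Metric.closedBall c (ℓ / 2) := by
  ext x
  simp [cube, dist_eq_norm]

theorem measurableSet_cube (n : ℕ) (c : Fin n → ℝ) (ℓ : ℝ) : MeasurableSet (cube n c ℓ) := by
  rw [cube_eq_closedBall]
  exact Metric.isClosed_closedBall.measurableSet

theorem volume_cube (n : ℕ) (c : Fin n → ℝ) {ℓ : ℝ} (hℓ : 0 ≤ ℓ) :
    volume (cube n c ℓ) = ENNReal.ofReal (ℓ ^ n) := by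
  rw [cube_eq_closedBall, Real.volume_pi_closedBall _ (by positivity), Fintype.card_fin,
    mul_div_cancel₀ _ two_ne_zero]

theorem Mfun_nonneg (n : ℕ) (c : Fin n → ℝ) (ℓ : ℝ) : 0 ≤ Mfun n c ℓ := by
  apply Real.sInf_nonneg
  rintro r ⟨x, -, y, -, z, -, rfl⟩
  positivity

theorem Mfun_le {n : ℕ} {c x y z : Fin n → ℝ} {ℓ : ℝ} (hx : x ∈ cube n c ℓ)
    (hy : y ∈ cube n c ℓ) (hz : z ∈ cube n c ℓ) :
    Mfun n c ℓ ≤ 1 + (‖x + y‖ + ‖x + z‖) / (1 + (‖x - y‖ + ‖x - z‖)) := by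
  have hs : 0 < 1 + (‖x - y‖ + ‖x - z‖) := by positivity
  have hbdd : BddBelow {r : ℝ | ∃ x ∈ cube n c ℓ, ∃ y ∈ cube n c ℓ, ∃ z ∈ cube n c ℓ,
      r = (1 + ‖x - y‖ + ‖x - z‖ + ‖x + y‖ + ‖x + z‖) / (1 + ‖x - y‖ + ‖x - z‖)} := by
    refine ⟨0, ?_⟩
    rintro r ⟨x, -, y, -, z, -, rfl⟩
    positivity
  refine (csInf_le hbdd ⟨x, hx, y, hy, z, hz, rfl⟩).trans_eq ?_
  rw [one_add_div hs.ne']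
  simp only [add_assoc]

/-- The sup norm of an integer vector is an integer. -/
theorem exists_int_eq_norm {n : ℕ} (v : Fin n → ℤ) :
    ∃ a : ℤ, ‖(fun i => (v i : ℝ) : Fin n → ℝ)‖ = a := by
  rcases isEmpty_or_nonempty (Fin n) with _ | _
  · exact ⟨0, by simp [Subsingleton.elim (fun i => (v i : ℝ)) 0]⟩
  · obtain ⟨i, -, hi⟩ := Finset.exists_mem_eq_sup Finset.univ Finset.univ_nonempty
      fun i => ‖(v i : ℝ)‖₊
    exact ⟨|v i|, by rw [Pi.norm_def, hi, coe_nnnorm, Real.norm_eq_abs, Int.cast_abs]⟩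

/-- Points of two translated cubes differ by the translation vector up to `ℓ`. -/
theorem abs_norm_sub_sub_le {n : ℕ} {c x y v : Fin n → ℝ} {ℓ : ℝ} (hℓ : 0 ≤ ℓ)
    (hx : x ∈ cube n c ℓ) (hy : y ∈ cube n (c + ℓ • v) ℓ) :
    |‖x - y‖ - ℓ * ‖v‖| ≤ ℓ := by
  have hx' : ‖x - c‖ ≤ ℓ / 2 := hx
  have hy' : ‖y - (c + ℓ • v)‖ ≤ ℓ / 2 := hy
  have hv : ‖ℓ • v‖ = ℓ * ‖v‖ := by rw [norm_smul, Real.norm_of_nonneg hℓ]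
  rw [← hv, norm_sub_rev x y]
  calc |‖y - x‖ - ‖ℓ • v‖| ≤ ‖(y - x) - ℓ • v‖ := abs_norm_sub_norm_le _ _
    _ = ‖(y - (c + ℓ • v)) - (x - c)‖ := by congr 1; abel
    _ ≤ ‖y - (c + ℓ • v)‖ + ‖x - c‖ := norm_sub_le _ _
    _ ≤ ℓ := by linarith

theorem setLIntegral_cube_le {n : ℕ} {c : Fin n → ℝ} {ℓ A : ℝ} (hℓ : 0 ≤ ℓ) (hA : 0 ≤ A)
    {f : (Fin n → ℝ) → ENNReal} (hf : ∀ x ∈ cube n c ℓ, f x ≤ ENNReal.ofReal A) :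
    ∫⁻ x in cube n c ℓ, f x ≤ ENNReal.ofReal (A * ℓ ^ n) := by
  refine (setLIntegral_mono' (measurableSet_cube n c ℓ) hf).trans_eq ?_
  rw [setLIntegral_const, volume_cube n c hℓ, ENNReal.ofReal_mul hA]

theorem separated_cubes_bounds {n : ℕ} {ℓ : ℝ} (hℓ : 0 < ℓ) {k : ℕ} (hk : 3 ≤ k)
    {n₁ n₂ : Fin n → ℤ}
    (hlb : (2 : ℝ) ^ (k - 3) <
      max ‖(fun i => (n₁ i : ℝ) : Fin n → ℝ)‖ ‖(fun i => (n₂ i : ℝ) : Fin n → ℝ)‖)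
    (hub : max ‖(fun i => (n₁ i : ℝ) : Fin n → ℝ)‖ ‖(fun i => (n₂ i : ℝ) : Fin n → ℝ)‖ ≤
      (2 : ℝ) ^ (k - 2))
    {c x y z : Fin n → ℝ} (hx : x ∈ cube n c ℓ)
    (hy : y ∈ cube n (c + ℓ • (fun i => (n₁ i : ℝ))) ℓ)
    (hz : z ∈ cube n (c + ℓ • (fun i => (n₂ i : ℝ))) ℓ) :
    (2 : ℝ) ^ (k - 3) * ℓ ≤ max ‖x - y‖ ‖x - z‖ ∧ ‖x - y‖ + ‖x - z‖ ≤ 2 ^ k * ℓ := by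
  have hy' := abs_le.1 (abs_norm_sub_sub_le hℓ.le hx hy)
  have hz' := abs_le.1 (abs_norm_sub_sub_le hℓ.le hx hz)
  obtain ⟨a, ha⟩ := exists_int_eq_norm n₁
  obtain ⟨b, hb⟩ := exists_int_eq_norm n₂
  rw [ha, hb] at hlb hub
  rw [ha] at hy'
  rw [hb] at hz'
  obtain ⟨j, rfl⟩ := Nat.exists_eq_add_of_le' hk
  rw [show j + 3 - 2 = j + 1 from rfl] at hub
  rw [show j + 3 - 3 = j from rfl] at hlb ⊢
  have hstep {p : ℤ} (hp : (2 : ℝ) ^ j < p) : (2 : ℝ) ^ j * ℓ ≤ ℓ * p - ℓ := by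
    have h : (2 : ℤ) ^ j + 1 ≤ p := by
      have : (2 : ℤ) ^ j < p := by exact_mod_cast hp
      omega
    have h' : (2 : ℝ) ^ j + 1 ≤ p := by exact_mod_cast h
    nlinarith
  constructor
  · rcases lt_max_iff.1 hlb with h | h
    · exact le_max_of_le_left (by linarith [hstep h])
    · exact le_max_of_le_right (by linarith [hstep h])
  · obtain ⟨hA, hB⟩ := max_le_iff.1 hub
    have hj : (1 : ℝ) ≤ 2 ^ j := one_le_pow₀ one_le_two
    rw [pow_succ] at hA hB
    rw [pow_add]
    nlinarith [mul_le_mul_of_nonneg_left hA hℓ.le, mul_le_mul_of_nonneg_left hB hℓ.le,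
      mul_le_mul_of_nonneg_left hj hℓ.le]

theorem subadditive_four_mul_le {ω : ℝ → ℝ}
    (hωsub : ∀ s t : ℝ, 0 ≤ s → 0 ≤ t → ω (s + t) ≤ ω s + ω t) {t : ℝ} (ht : 0 ≤ t) :
    ω (4 * t) ≤ 4 * ω t := by
  have h₁ := hωsub t t ht ht
  have h₂ := hωsub (t + t) (t + t) (by positivity) (by positivity)
  rw [show 4 * t = t + t + (t + t) by ring]
  linarith

/-- the quantitative kernel estimate in the separated-cubes case. If `K` satisfies
the compact Calderón–Zygmund smoothness estimate with modulus `ω` and factors `F₁, F₂, F₃`, and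
`I = Q(c,ℓ)`, `I₁ = I + ℓn₁`, `I₂ = I + ℓn₂` with `2^{k-3} < max(|n₁|,|n₂|) ≤ 2^{k-2}`, `k ≥ 3`,
and `K₀ = Q(c₀,L₀)` is any cube containing `I ∪ I₁ ∪ I₂`, then
(a) `2^{k-3} ℓ ≤ |x−y|+|x−z| ≤ 2^k ℓ` for `x ∈ I`, `y ∈ I₁`, `z ∈ I₂`, and
(b) `∫_{I₁}∫_{I₂}∫_I |K(x,y,z)−K(c,y,z)| dx dz dy
      ≤ 2^{6n+2} C₀ ω(2^{-k}) F₁(2^k ℓ) F₂(2^{k-3} ℓ) F₃(M(K₀)) ℓ^{3n} / (2^k ℓ)^{2n}`. -/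
theorem stmt10 (n : ℕ) (hn : 1 ≤ n) (C₀ : ℝ) (hC₀ : 0 < C₀)
    (ω : ℝ → ℝ) (hω0 : ∀ t, 0 ≤ t → 0 ≤ ω t)
    (hωmono : MonotoneOn ω (Set.Ici (0 : ℝ)))
    (hωsub : ∀ s t : ℝ, 0 ≤ s → 0 ≤ t → ω (s + t) ≤ ω s + ω t)
    (F₁ F₂ F₃ : ℝ → ℝ)
    (h₁0 : ∀ t, 0 ≤ t → 0 ≤ F₁ t) (h₂0 : ∀ t, 0 ≤ t → 0 ≤ F₂ t)
    (h₃0 : ∀ t, 0 ≤ t → 0 ≤ F₃ t)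
    (h₁mono : MonotoneOn F₁ (Set.Ici (0 : ℝ)))
    (h₂anti : AntitoneOn F₂ (Set.Ici (0 : ℝ)))
    (h₃anti : AntitoneOn F₃ (Set.Ici (0 : ℝ)))
    (K : (Fin n → ℝ) → (Fin n → ℝ) → (Fin n → ℝ) → ℂ)
    (hKmeas : Measurable fun q : (Fin n → ℝ) × (Fin n → ℝ) × (Fin n → ℝ) =>
      K q.1 q.2.1 q.2.2)
    (hK : ∀ x x' y z : Fin n → ℝ,
      ‖x - x'‖ ≤ max ‖x - y‖ ‖x - z‖ / 2 → 0 < ‖x - y‖ + ‖x - z‖ →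
      ‖K x y z - K x' y z‖ ≤
        C₀ * ω (‖x - x'‖ / (‖x - y‖ + ‖x - z‖)) *
          F₁ (‖x - y‖ + ‖x - z‖) * F₂ (‖x - y‖ + ‖x - z‖) *
          F₃ (1 + (‖x + y‖ + ‖x + z‖) / (1 + (‖x - y‖ + ‖x - z‖))) /
          (‖x - y‖ + ‖x - z‖) ^ (2 * n))
    (ℓ : ℝ) (hℓ : 0 < ℓ) (k : ℕ) (hk : 3 ≤ k)
    (n₁ n₂ : Fin n → ℤ) (m : ℝ)
    (hm : m = max ‖(fun i => (n₁ i : ℝ) : Fin n → ℝ)‖ ‖(fun i => (n₂ i : ℝ) : Fin n → ℝ)‖)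
    (hmlb : (2 : ℝ) ^ (k - 3) < m) (hmub : m ≤ (2 : ℝ) ^ (k - 2))
    (c c₀ : Fin n → ℝ) (L₀ : ℝ)
    (hK₀ : cube n c ℓ ∪ cube n (c + ℓ • (fun i => (n₁ i : ℝ))) ℓ ∪
        cube n (c + ℓ • (fun i => (n₂ i : ℝ))) ℓ ⊆ cube n c₀ L₀) :
    (∀ x ∈ cube n c ℓ, ∀ y ∈ cube n (c + ℓ • (fun i => (n₁ i : ℝ))) ℓ,
        ∀ z ∈ cube n (c + ℓ • (fun i => (n₂ i : ℝ))) ℓ,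
        (2 : ℝ) ^ (k - 3) * ℓ ≤ ‖x - y‖ + ‖x - z‖ ∧ ‖x - y‖ + ‖x - z‖ ≤ 2 ^ k * ℓ) ∧
    (∫⁻ y in cube n (c + ℓ • (fun i => (n₁ i : ℝ))) ℓ,
        ∫⁻ z in cube n (c + ℓ • (fun i => (n₂ i : ℝ))) ℓ,
          ∫⁻ x in cube n c ℓ, ENNReal.ofReal ‖K x y z - K c y z‖) ≤
      ENNReal.ofReal (2 ^ (6 * n + 2) * C₀ * ω ((2 : ℝ)⁻¹ ^ k) * F₁ (2 ^ k * ℓ) *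
        F₂ ((2 : ℝ) ^ (k - 3) * ℓ) * F₃ (Mfun n c₀ L₀) * ℓ ^ (3 * n) /
        (2 ^ k * ℓ) ^ (2 * n)) := by
  subst hm
  have hbd {x y z : Fin n → ℝ} (hx : x ∈ cube n c ℓ)
      (hy : y ∈ cube n (c + ℓ • (fun i => (n₁ i : ℝ))) ℓ)
      (hz : z ∈ cube n (c + ℓ • (fun i => (n₂ i : ℝ))) ℓ) :=
    separated_cubes_bounds hℓ hk hmlb hmub hx hy hz
  have hmax (x y z : Fin n → ℝ) : max ‖x - y‖ ‖x - z‖ ≤ ‖x - y‖ + ‖x - z‖ :=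
    max_le_add_of_nonneg (norm_nonneg _) (norm_nonneg _)
  refine ⟨fun x hx y hy z hz => ⟨(hbd hx hy hz).1.trans (hmax x y z), (hbd hx hy hz).2⟩, ?_⟩
  have hk2 : (2 : ℝ) ^ k = 2 ^ (k - 3) * 8 := by
    rw [show (8 : ℝ) = 2 ^ 3 by norm_num, ← pow_add, Nat.sub_add_cancel hk]
  have hpos : 0 < (2 : ℝ) ^ (k - 3) := by positivity
  have hone : (1 : ℝ) ≤ 2 ^ (k - 3) := one_le_pow₀ one_le_two
  have hM := Mfun_nonneg n c₀ L₀
  have hω := hω0 ((2 : ℝ)⁻¹ ^ k) (by positivity)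
  have hF₁ := h₁0 (2 ^ k * ℓ) (by positivity)
  have hF₂ := h₂0 ((2 : ℝ) ^ (k - 3) * ℓ) (by positivity)
  have hF₃ := h₃0 _ hM
  set B : ℝ := C₀ * (4 * ω ((2 : ℝ)⁻¹ ^ k)) * F₁ (2 ^ k * ℓ) * F₂ ((2 : ℝ) ^ (k - 3) * ℓ) *
    F₃ (Mfun n c₀ L₀) / ((2 : ℝ) ^ (k - 3) * ℓ) ^ (2 * n) with hB
  have hB0 : 0 ≤ B := by positivity
  have key : ∀ y ∈ cube n (c + ℓ • (fun i => (n₁ i : ℝ))) ℓ,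
      ∀ z ∈ cube n (c + ℓ • (fun i => (n₂ i : ℝ))) ℓ, ∀ x ∈ cube n c ℓ,
      ‖K x y z - K c y z‖ ≤ B := by
    intro y hy z hz x hx
    obtain ⟨hlo, hup⟩ := hbd hx hy hz
    have hxc : ‖x - c‖ ≤ ℓ / 2 := hx
    have hs := hlo.trans (hmax x y z)
    have hℓs : ℓ ≤ 2 ^ (k - 3) * ℓ := le_mul_of_one_le_left hℓ.le hone
    have hs0 : 0 < ‖x - y‖ + ‖x - z‖ := by linarith
    refine (hK x c y z (by linarith) hs0).trans ?_
    have hωle : ω (‖x - c‖ / (‖x - y‖ + ‖x - z‖)) ≤ 4 * ω ((2 : ℝ)⁻¹ ^ k) := by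
      refine (hωmono (Set.mem_Ici.2 (by positivity))
        (Set.mem_Ici.2 (by positivity : 0 ≤ 4 * (2 : ℝ)⁻¹ ^ k)) ?_).trans
        (subadditive_four_mul_le hωsub (by positivity))
      calc ‖x - c‖ / (‖x - y‖ + ‖x - z‖) ≤ (ℓ / 2) / (2 ^ (k - 3) * ℓ) := by gcongr
        _ = 4 * (2 : ℝ)⁻¹ ^ k := by
          rw [inv_pow, hk2]
          field_simp
          norm_num
    have hF₁le : F₁ (‖x - y‖ + ‖x - z‖) ≤ F₁ (2 ^ k * ℓ) :=
      h₁mono hs0.le (Set.mem_Ici.2 (by positivity)) hup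
    have hF₂le : F₂ (‖x - y‖ + ‖x - z‖) ≤ F₂ (2 ^ (k - 3) * ℓ) :=
      h₂anti (Set.mem_Ici.2 (by positivity)) hs0.le hs
    have hF₃le : F₃ (1 + (‖x + y‖ + ‖x + z‖) / (1 + (‖x - y‖ + ‖x - z‖))) ≤
        F₃ (Mfun n c₀ L₀) :=
      h₃anti hM (Set.mem_Ici.2 (by positivity)) (Mfun_le (hK₀ (.inl (.inl hx)))
        (hK₀ (.inl (.inr hy))) (hK₀ (.inr hz)))
    have g₁ := h₁0 _ hs0.le
    have g₂ := h₂0 _ hs0.le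
    have g₃ := h₃0 (1 + (‖x + y‖ + ‖x + z‖) / (1 + (‖x - y‖ + ‖x - z‖))) (by positivity)
    rw [hB]
    gcongr
  refine (setLIntegral_cube_le hℓ.le (A := B * ℓ ^ n * ℓ ^ n) (by positivity) fun y hy =>
    setLIntegral_cube_le hℓ.le (by positivity) fun z hz =>
      setLIntegral_cube_le hℓ.le hB0 fun x hx =>
        ENNReal.ofReal_le_ofReal (key y hy z hz x hx)).trans_eq ?_
  congr 1
  rw [hB, hk2, mul_right_comm _ (8 : ℝ) ℓ, mul_pow _ (8 : ℝ),
    show (8 : ℝ) ^ (2 * n) = 2 ^ (6 * n) by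
      rw [show (8 : ℝ) = 2 ^ 3 by norm_num, ← pow_mul]; ring_nf]
  field_simp
  ring
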